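/- arXiv:2012.11166 — 3 statements merged into one kernel-verified Lean document; each statement's English description precedes it below -/
import Mathlib

section
/- Assume 1 ≤ s < d < m, 1 ≤ r ≤ m−1, ms ≥ d(m−r), and r < m − s. Then for every F_q-linear subspace U ⊆ F_{q^m} of dimension d, bad(U) is nonempty; that is, there exist (x_1,…,x_{m−r}) ∈ (F_{q^m})^{m−r} with F_q-linearly independent entries and a nonzero tuple (u_1,…,u_{m−r}) ∈ U^{m−r} such that ∑_{j=1}^{m−r} u_j^{q^ℓ} x_j = 0 for all 1 ≤ ℓ ≤ s. -/
open Finset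

/-- `bad(U)`: the set of `x ∈ Ω` for which there is a not-all-zero tuple `u` with entries in `U`
such that `∑ⱼ uⱼ^{q^ℓ} xⱼ = 0` for all `1 ≤ ℓ ≤ s`. -/
def badSet (F : Type*) {E : Type*} [Field F] [Field E] [Algebra F E]
    (q s k : ℕ) (U : Set E) : Set (Fin k → E) :=
  {x | LinearIndependent F x ∧ ∃ u : Fin k → E, (∀ j, u j ∈ U) ∧ u ≠ 0 ∧
      ∀ ℓ : ℕ, 1 ≤ ℓ → ℓ ≤ s → ∑ j, u j ^ q ^ ℓ * x j = 0}

/-- The `q`-power Moore matrix of an `F`-linearly independent family is nonsingular. -/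
theorem eq_zero_of_sum_pow_card_pow_mul_eq_zero {F E : Type*} [Field F] [Fintype F] [Field E]
    [Algebra F E] {n : ℕ} {w : Fin n → E} (hw : LinearIndependent F w) {y : Fin n → E}
    (hy : ∀ i < n, ∑ j, w j ^ Fintype.card F ^ i * y j = 0) : y = 0 := by
  classical
  by_contra hy0
  have hq : 1 < Fintype.card F := Fintype.one_lt_card
  let M : Matrix (Fin n) (Fin n) E := .of fun j i => w j ^ Fintype.card F ^ (i : ℕ)
  have hM : M.det = 0 := by
    refine Matrix.exists_vecMul_eq_zero_iff.1 ⟨y, hy0, ?_⟩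
    ext i
    simpa [Matrix.vecMul, dotProduct, M, mul_comm] using hy i i.2
  obtain ⟨c, hc0, hc⟩ := Matrix.exists_mulVec_eq_zero_iff.2 hM
  let L : E →ₗ[F] E := ∑ i : Fin n, c i • ((FiniteField.frobeniusAlgHom F E) ^ (i : ℕ)).toLinearMap
  have hL (e : E) : L e = ∑ i, c i * e ^ Fintype.card F ^ (i : ℕ) := by
    simp [L, LinearMap.sum_apply, AlgHom.coe_pow, FiniteField.coe_frobeniusAlgHom, pow_iterate]
  have hLw (j : Fin n) : L (w j) = 0 := by
    rw [hL]
    simpa [Matrix.mulVec, dotProduct, M, mul_comm] using congrFun hc j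
  let P : Polynomial E :=
    ∑ i : Fin n, Polynomial.monomial (Fintype.card F ^ (i : ℕ)) (c i)
  have hP : P = 0 := by
    refine Polynomial.eq_zero_of_natDegree_lt_card_of_eval_eq_zero P
      (linearIndependent_iff_injective_fintypeLinearCombination.1 hw) (fun a => ?_) ?_
    · have h : P.eval (Fintype.linearCombination F w a) = L (Fintype.linearCombination F w a) := by
        simp only [P, hL, Polynomial.eval_finsetSum, Polynomial.eval_monomial]
      rw [h, Fintype.linearCombination_apply, map_sum]
      simp [hLw]
    · rw [Fintype.card_fun, Fintype.card_fin]
      have hpos : 0 < Fintype.card F ^ n := by positivity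
      refine (Nat.le_sub_one_iff_lt hpos).1 (Polynomial.natDegree_sum_le_of_forall_le _ _ ?_)
      intro i _
      refine (Polynomial.natDegree_monomial_le _).trans ?_
      exact (Nat.le_sub_one_iff_lt hpos).2 (Nat.pow_lt_pow_right hq i.2)
  refine hc0 (funext fun i => ?_)
  have h := congrArg (fun p => p.coeff (Fintype.card F ^ (i : ℕ))) hP
  simpa [P, Polynomial.finsetSum_coeff, Polynomial.coeff_monomial,
    Nat.pow_right_inj hq, Fin.val_inj] using h

/-- A nonzero `y` orthogonal to the `q ^ ℓ`-th powers, `1 ≤ ℓ ≤ s`, of an `F`-linearly independent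
family of size `s + 1` is itself `F`-linearly independent. -/
theorem linearIndependent_of_sum_pow_card_pow_mul_eq_zero {F E : Type*} [Field F] [Fintype F]
    [Field E] [Algebra F E] {s : ℕ} {u : Fin (s + 1) → E} (hu : LinearIndependent F u)
    {y : Fin (s + 1) → E} (hy0 : y ≠ 0)
    (hy : ∀ ℓ, 1 ≤ ℓ → ℓ ≤ s → ∑ j, u j ^ Fintype.card F ^ ℓ * y j = 0) :
    LinearIndependent F y := by
  classical
  rw [Fintype.linearIndependent_iff]
  by_contra! h
  obtain ⟨g, hg, j₀, hj₀⟩ := h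
  let c : Fin (s + 1) → F := fun j => if j = j₀ then 0 else -(g j / g j₀)
  have hcy : ∑ j, c j • y j = y j₀ := by
    have h (j) : c j • y j = (if j = j₀ then y j else 0) - (g j₀)⁻¹ • (g j • y j) := by
      by_cases hj : j = j₀
      · subst hj
        simp [c, smul_smul, hj₀]
      · simp [c, hj, smul_smul, div_eq_inv_mul]
    simp [h, Finset.sum_sub_distrib, ← Finset.smul_sum, hg]
  have hv : LinearIndependent F (u + (c · • u j₀)) :=
    (linearIndependent_add_smul_iff (by simp [c])).2 hu
  set φ := FiniteField.frobeniusAlgHom F E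
  have hφ (ℓ : ℕ) (e : E) : e ^ Fintype.card F ^ ℓ = (φ ^ ℓ) e := by
    simp [φ, AlgHom.coe_pow, FiniteField.coe_frobeniusAlgHom, pow_iterate]
  have hw := (hv.comp _ (Fin.succAbove_right_injective (p := j₀))).map' φ.toLinearMap
    (LinearMap.ker_eq_bot.2 φ.injective)
  have key : (fun j => y (j₀.succAbove j)) = 0 := by
    refine eq_zero_of_sum_pow_card_pow_mul_eq_zero hw fun i hi => ?_
    have h1 := hy (i + 1) (by omega) hi
    have h2 : ∑ j, (φ ^ (i + 1)) (u j + c j • u j₀) * y j = (φ ^ (i + 1)) (u j₀) * y j₀ := by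
      simp only [map_add, map_smul, add_mul, Finset.sum_add_distrib, ← hcy, Finset.mul_sum]
      simp only [← hφ, h1, zero_add]
      simp
    rw [Fin.sum_univ_succAbove _ j₀] at h2
    simpa [c, hφ, pow_succ] using h2
  have hyj (j) : y (j₀.succAbove j) = 0 := congrFun key j
  have : g j₀ • y j₀ = 0 := by
    rw [Fin.sum_univ_succAbove _ j₀] at hg
    simpa [hyj] using hg
  refine hy0 (funext fun j => ?_)
  induction j using Fin.succAboveCases j₀ with
  | x => simpa [hj₀] using this
  | p j => exact hyj j

theorem badSet_succ_nonempty {F E : Type*} [Field F] [Field E] [Algebra F E] {q s k : ℕ}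
    (hq : q ≠ 0) {U : Submodule F E} (hk : k < Module.finrank F E)
    (h : (badSet F q s k (U : Set E)).Nonempty) :
    (badSet F q s (k + 1) (U : Set E)).Nonempty := by
  obtain ⟨x, hx, u, huU, hu0, hu⟩ := h
  obtain ⟨z, hz⟩ := exists_linearIndependent_snoc_of_lt_finrank hx hk
  refine ⟨_, hz, Fin.snoc u 0, fun j => ?_, fun h0 => hu0 (funext fun j => ?_), fun ℓ h1 h2 => ?_⟩
  · refine Fin.lastCases ?_ (fun j => ?_) j
    · simp
    · simpa using huU j
  · simpa using congrFun h0 j.castSucc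
  · simpa [Fin.sum_univ_castSucc, hq] using hu ℓ h1 h2

/-- If `1 ≤ s < d < m`, `1 ≤ r ≤ m - 1`, `ms ≥ d(m-r)` and `r < m - s`, then
for every `F_q`-subspace `U ⊆ F_{q^m}` of dimension `d`, `bad(U)` is nonempty. -/
theorem stmt_16 {F E : Type*} [Field F] [Fintype F] [Field E] [Fintype E] [Algebra F E]
    (q m s d r : ℕ) (hq : Fintype.card F = q) (hm : Module.finrank F E = m)
    (hs1 : 1 ≤ s) (hsd : s < d) (hdm : d < m) (hr1 : 1 ≤ r) (hrm : r ≤ m - 1)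
    (hms : d * (m - r) ≤ m * s) (hrs : r < m - s)
    (U : Submodule F E) (hU : Module.finrank F U = d) :
    (badSet F q s (m - r) (U : Set E)).Nonempty := by
  subst hq
  obtain ⟨v, hv⟩ := exists_linearIndependent_of_le_finrank
    (R := F) (M := U) (n := s + 1) (by omega)
  have hu : LinearIndependent F (U.subtype ∘ v) := hv.map' _ U.ker_subtype
  have hbase : (badSet F (Fintype.card F) s (s + 1) (U : Set E)).Nonempty := by
    let T : (Fin (s + 1) → E) →ₗ[E] (Fin s → E) :=
      (Matrix.of fun (ℓ : Fin s) j => (v j : E) ^ Fintype.card F ^ (ℓ + 1 : ℕ)).mulVecLin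
    obtain ⟨y, hy, hy0⟩ := (Submodule.ne_bot_iff _).1
      (T.ker_ne_bot_of_finrank_lt (by simp))
    have hy' (ℓ : ℕ) (h1 : 1 ≤ ℓ) (h2 : ℓ ≤ s) :
        ∑ j, (U.subtype ∘ v) j ^ Fintype.card F ^ ℓ * y j = 0 := by
      obtain ⟨i, rfl⟩ := Nat.exists_eq_add_of_le' h1
      simpa [T, Matrix.mulVec, dotProduct] using congrFun (LinearMap.mem_ker.1 hy) ⟨i, h2⟩
    exact ⟨y, linearIndependent_of_sum_pow_card_pow_mul_eq_zero hu hy0 hy', U.subtype ∘ v,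
      fun j => (v j).2, fun h => hu.ne_zero 0 (congrFun h 0), hy'⟩
  have hext (k : ℕ) (hk : s + 1 ≤ k) :
      k ≤ m → (badSet F (Fintype.card F) s k (U : Set E)).Nonempty := by
    induction k, hk using Nat.le_induction with
    | base => exact fun _ => hbase
    | succ k _ ih =>
      exact fun h => badSet_succ_nonempty Fintype.card_ne_zero (by omega) (ih (by omega))
  exact hext _ (by omega) (Nat.sub_le _ _)
end

section
/- Assume 1 ≤ s, 1 ≤ r ≤ m−1, (m−r) divides m, d < m, and ms ≥ d(m−r). Let α be a primitive element of F_{q^m} (a generator of the multiplicative group F_{q^m}^×), let U be the F_q-span of 1, α, α^2, …, α^{d−1} (an F_q-subspace of dimension d), and let V = (F_{q^{m−r}})^⊥ = { x ∈ F_{q^m} : Tr(xy) = 0 for all y ∈ F_{q^{m−r}} }, where F_{q^{m−r}} is the subfield of F_{q^m} with q^{m−r} elements (so V has F_q-dimension r). Then the pair (U, V) is good. -/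
open Finset

/-- The trace-dual of an `F`-subspace `V` of `E`, where `Tr(x) = ∑_{i<m} x^{q^i}`:
`V^⊥ = {x : ∀ v ∈ V, Tr(v*x) = 0}`. -/
def traceDual {F E : Type*} [Field F] [Fintype F] [Field E] [Fintype E] [Algebra F E]
    (q m : ℕ) (hq : Fintype.card F = q) (V : Submodule F E) : Submodule F E where
  carrier := {x : E | ∀ v ∈ V, ∑ i ∈ Finset.range m, (v * x) ^ q ^ i = 0}
  zero_mem' := by
    intro v hv
    have hq0 : q ≠ 0 := by
      have h1 : 0 < Fintype.card F := Fintype.card_pos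
      omega
    refine Finset.sum_eq_zero fun i _ => ?_
    rw [mul_zero, zero_pow (pow_ne_zero i hq0)]
  add_mem' := by
    intro x y hx hy v hv
    obtain ⟨n, hp, hcard⟩ := FiniteField.card F (ringChar F)
    haveI : Fact (Nat.Prime (ringChar F)) := ⟨hp⟩
    haveI : CharP E (ringChar F) :=
      charP_of_injective_algebraMap (algebraMap F E).injective (ringChar F)
    have hq' : q = ringChar F ^ (n : ℕ) := by rw [← hq, hcard]
    have key : ∀ a b : E, ∀ i : ℕ, (a + b) ^ q ^ i = a ^ q ^ i + b ^ q ^ i := by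
      intro a b i
      rw [hq', ← pow_mul]
      exact add_pow_char_pow a b (ringChar F) ((n : ℕ) * i)
    calc ∑ i ∈ Finset.range m, (v * (x + y)) ^ q ^ i
        = ∑ i ∈ Finset.range m, ((v * x) ^ q ^ i + (v * y) ^ q ^ i) := by
          refine Finset.sum_congr rfl fun i _ => ?_
          rw [mul_add, key]
      _ = 0 := by rw [Finset.sum_add_distrib, hx v hv, hy v hv, add_zero]
  smul_mem' := by
    intro c x hx v hv
    have hc : ∀ i : ℕ, (algebraMap F E c) ^ q ^ i = algebraMap F E c := by
      intro i
      rw [← map_pow]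
      congr 1
      calc c ^ q ^ i = c ^ Fintype.card F ^ i := by rw [hq]
        _ = c := FiniteField.pow_card_pow i c
    calc ∑ i ∈ Finset.range m, (v * (c • x)) ^ q ^ i
        = ∑ i ∈ Finset.range m, algebraMap F E c * (v * x) ^ q ^ i := by
          refine Finset.sum_congr rfl fun i _ => ?_
          rw [Algebra.smul_def, mul_left_comm, mul_pow, hc]
      _ = algebraMap F E c * ∑ i ∈ Finset.range m, (v * x) ^ q ^ i := (Finset.mul_sum _ _ _).symm
      _ = 0 := by rw [hx v hv, mul_zero]

/-- A pair `(U, V)` of `F`-subspaces of `E` is *good* (for the parameter `s`) if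
`m·s ≥ dim U · (m - dim V)` and for every `F`-basis `u₁, …, u_{dim U}` of `U` and all
`v'ᵢ ∈ V^⊥`: if `∑ᵢ v'ᵢ · uᵢ^{q^ℓ} = 0` for every `1 ≤ ℓ ≤ s`, then all `v'ᵢ = 0`. -/
def IsGoodPair {F E : Type*} [Field F] [Fintype F] [Field E] [Fintype E] [Algebra F E]
    (q m s : ℕ) (hq : Fintype.card F = q) (U V : Submodule F E) : Prop :=
  m * s ≥ Module.finrank F U * (m - Module.finrank F V) ∧
  ∀ u : Fin (Module.finrank F U) → E,
    (∀ i, u i ∈ U) → LinearIndependent F u → Submodule.span F (Set.range u) = U →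
  ∀ v' : Fin (Module.finrank F U) → E,
    (∀ i, v' i ∈ traceDual q m hq V) →
    (∀ ℓ : ℕ, 1 ≤ ℓ → ℓ ≤ s → ∑ i, v' i * u i ^ q ^ ℓ = 0) →
    ∀ i, v' i = 0

/-- A subfield of `E` containing the image of `F`, viewed as an `F`-submodule of `E`. -/
def subfieldSubmodule (F : Type*) {E : Type*} [Field F] [Field E] [Algebra F E]
    (K : Subfield E) (hFK : ∀ c : F, algebraMap F E c ∈ K) : Submodule F E where
  carrier := K
  add_mem' := fun hx hy => K.add_mem hx hy
  zero_mem' := K.zero_mem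
  smul_mem' := fun c x hx => by
    rw [Algebra.smul_def]; exact K.mul_mem (hFK c) hx

open FiniteField in
theorem frobeniusAlgEquivOfAlgebraic_pow_apply (F : Type*) {E : Type*} [Field F] [Fintype F]
    [Field E] [Algebra F E] [Algebra.IsAlgebraic F E] (n : ℕ) (x : E) :
    (frobeniusAlgEquivOfAlgebraic F E ^ n) x = x ^ Fintype.card F ^ n := by
  rw [AlgEquiv.coe_pow, coe_frobeniusAlgEquivOfAlgebraic_iterate]

open Algebra in
theorem traceDual_eq_orthogonal {F E : Type*} [Field F] [Fintype F] [Field E] [Fintype E]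
    [Algebra F E] {q m : ℕ} (hq : Fintype.card F = q) (hm : Module.finrank F E = m)
    (W : Submodule F E) :
    traceDual q m hq W = (traceForm F E).orthogonal W := by
  ext x
  rw [LinearMap.BilinForm.mem_orthogonal_iff]
  refine forall₂_congr fun v _ => ?_
  rw [traceForm_apply,
    ← (algebraMap F E).injective.eq_iff, map_zero, FiniteField.algebraMap_trace_eq_sum_pow, hm,
    Nat.card_eq_fintype_card, hq]

theorem traceDual_traceDual {F E : Type*} [Field F] [Fintype F] [Field E] [Fintype E]
    [Algebra F E] {q m : ℕ} (hq : Fintype.card F = q) (hm : Module.finrank F E = m)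
    (W : Submodule F E) :
    traceDual q m hq (traceDual q m hq W) = W := by
  rw [traceDual_eq_orthogonal hq hm, traceDual_eq_orthogonal hq hm]
  exact LinearMap.BilinForm.orthogonal_orthogonal (traceForm_nondegenerate F E)
    (Algebra.traceForm_isSymm F).isRefl W

/-- The conjugates `α ^ q ^ n`, `n < [E : F]`, of a primitive element are distinct. -/
theorem modEq_of_primitive_pow_eq {F E : Type*} [Field F] [Fintype F] [Field E] [Fintype E]
    [Algebra F E] {α : E} (hα : ∀ x : E, x ≠ 0 → ∃ k : ℕ, x = α ^ k) {a b : ℕ}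
    (hab : α ^ Fintype.card F ^ a = α ^ Fintype.card F ^ b) :
    a ≡ b [MOD Module.finrank F E] := by
  rw [← FiniteField.orderOf_frobeniusAlgEquivOfAlgebraic F E, ← pow_eq_pow_iff_modEq]
  ext x
  rcases eq_or_ne x 0 with rfl | hx
  · simp
  · obtain ⟨k, rfl⟩ := hα x hx
    rw [map_pow, map_pow, frobeniusAlgEquivOfAlgebraic_pow_apply,
      frobeniusAlgEquivOfAlgebraic_pow_apply, hab]

/-- A polynomial with coefficients fixed by `x ↦ x ^ q ^ t` that vanishes at `y` vanishes at
`y ^ q ^ (t * j)`. -/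
theorem sum_mul_pow_conj_eq_zero {F E ι : Type*} [Field F] [Fintype F] [Field E]
    [Algebra F E] [Algebra.IsAlgebraic F E] [Fintype ι] {t : ℕ} {w : ι → E} {e : ι → ℕ}
    (hw : ∀ i, w i ^ Fintype.card F ^ t = w i) {y : E} (hy : ∑ i, w i * y ^ e i = 0) (j : ℕ) :
    ∑ i, w i * (y ^ Fintype.card F ^ (t * j)) ^ e i = 0 := by
  induction j with
  | zero => simpa using hy
  | succ j ih =>
    have h := congrArg (FiniteField.frobeniusAlgEquivOfAlgebraic F E ^ t) ih
    simpa only [map_sum, map_mul, map_pow, map_zero, frobeniusAlgEquivOfAlgebraic_pow_apply, hw,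
      ← pow_mul, ← pow_add, Nat.mul_succ, mul_comm, mul_left_comm, mul_assoc, add_comm] using h

theorem eq_zero_of_sum_mul_primitive_conj_eq_zero {F E : Type*} [Field F] [Fintype F] [Field E]
    [Fintype E] [Algebra F E] {s t k d : ℕ} (hm : Module.finrank F E = t * k)
    (hds : d ≤ k * s) (hdt : d ≤ k * t)
    {α : E} (hα : ∀ x : E, x ≠ 0 → ∃ k : ℕ, x = α ^ k) {w : Fin d → E}
    (hw : ∀ i, w i ^ Fintype.card F ^ t = w i)
    (h : ∀ ℓ : ℕ, 1 ≤ ℓ → ℓ ≤ s → ∑ i, w i * (α ^ Fintype.card F ^ ℓ) ^ (i : ℕ) = 0) :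
    w = 0 := by
  obtain ⟨e⟩ : Nonempty (Fin d ↪ Fin k × Fin (min s t)) := by
    apply Function.Embedding.nonempty_of_card_le
    simpa [Nat.mul_min_mul_left] using le_min hds hdt
  refine Matrix.eq_zero_of_forall_index_sum_pow_mul_eq_zero
    (f := fun i => α ^ Fintype.card F ^ ((e i).2 + t * (e i).1 + 1 : ℕ)) ?_ ?_
  · intro i i' hii
    have hmod := (modEq_of_primitive_pow_eq (F := F) hα hii).add_right_cancel'
    have hlt (x : Fin k × Fin (min s t)) : (x.2 + t * x.1 : ℕ) < t * k := by
      have h1 := x.1.2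
      have h2 := x.2.2
      have h3 : t * (x.1 + 1) ≤ t * k := Nat.mul_le_mul_left t h1
      rw [Nat.mul_succ] at h3
      omega
    rw [hm] at hmod
    have heq := hmod.eq_of_lt_of_lt (hlt _) (hlt _)
    have h2 (x : Fin k × Fin (min s t)) : (x.2 : ℕ) < t := by have := x.2.2; omega
    have hmod' := congrArg (· % t) heq
    simp only [Nat.add_mul_mod_self_left, Nat.mod_eq_of_lt (h2 _)] at hmod'
    rw [hmod', Nat.add_left_cancel_iff] at heq
    apply e.injective
    ext
    · exact Nat.eq_of_mul_eq_mul_left (Nat.zero_lt_of_lt (h2 (e i))) heq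
    · exact hmod'
  · intro i
    have h2 := (e i).2.2
    have := sum_mul_pow_conj_eq_zero hw (h ((e i).2 + 1) (by omega) (by omega)) (e i).1
    rw [← pow_mul, ← pow_add] at this
    simpa only [mul_comm, add_right_comm] using this

/-- If `u` is linearly independent and `u i = ∑ j, a i j • b j`, then `v` is determined by the
combinations `∑ i, a i j • v i`. -/
theorem eq_zero_of_sum_smul_eq_zero {F M N ι κ : Type*} [Field F] [AddCommGroup M] [Module F M]
    [AddCommGroup N] [Module F N] [Fintype ι] [Fintype κ] {u : ι → M}
    (hu : LinearIndependent F u) {b : κ → M} {a : ι → κ → F} (hab : ∀ i, ∑ j, a i j • b j = u i)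
    {v : ι → N} (hv : ∀ j, ∑ i, a i j • v i = 0) (i : ι) : v i = 0 := by
  rw [← Module.forall_dual_apply_eq_zero_iff F]
  intro φ
  refine Fintype.linearIndependent_iff.1 hu (fun i => φ (v i)) ?_ i
  have h (j : κ) : ∑ i, φ (v i) * a i j = 0 := by
    simpa [mul_comm] using congrArg φ (hv j)
  simp_rw [← hab, smul_sum, smul_smul]
  rw [sum_comm]
  simp_rw [← sum_smul, h, zero_smul, sum_const_zero]

/-- Assume `1 ≤ s`, `1 ≤ r ≤ m - 1`, `(m - r) ∣ m`, `d < m`, and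
`ms ≥ d(m-r)`. Let `α` be a primitive element of `F_{q^m}`, let
`U = span_{F_q}(1, α, …, α^{d-1})` (of dimension `d`), and let `V = (F_{q^{m-r}})^⊥`, where
`F_{q^{m-r}}` is the subfield of `F_{q^m}` with `q^{m-r}` elements (so `V` has dimension `r`).
Then the pair `(U, V)` is good. -/
theorem stmt_17 {F E : Type*} [Field F] [Fintype F] [Field E] [Fintype E] [Algebra F E]
    (q m s d r : ℕ) (hq : Fintype.card F = q) (hm : Module.finrank F E = m)
    (hs1 : 1 ≤ s) (hr1 : 1 ≤ r) (hrm : r ≤ m - 1) (hdvd : (m - r) ∣ m) (hdm : d < m)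
    (hms : d * (m - r) ≤ m * s)
    (α : E) (hα : ∀ x : E, x ≠ 0 → ∃ k : ℕ, x = α ^ k)
    (K : Subfield E) (hKcard : Nat.card K = q ^ (m - r))
    (hFK : ∀ c : F, algebraMap F E c ∈ K)
    (hUdim : Module.finrank F
      (Submodule.span F (Set.range fun i : Fin d => α ^ (i : ℕ))) = d)
    (hVdim : Module.finrank F (traceDual q m hq (subfieldSubmodule F K hFK)) = r) :
    IsGoodPair q m s hq (Submodule.span F (Set.range fun i : Fin d => α ^ (i : ℕ)))
      (traceDual q m hq (subfieldSubmodule F K hFK)) := by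
  subst hq
  obtain ⟨k, hk⟩ := hdvd
  have ht : 0 < m - r := by omega
  refine ⟨?_, fun u huU hu _ v hv hsum => ?_⟩
  · rw [hUdim, hVdim]
    exact hms
  rw [traceDual_traceDual rfl hm] at hv
  have hKpow (x : E) (hx : x ∈ K) : x ^ Fintype.card F ^ (m - r) = x := by
    rw [← hKcard]
    have := Fintype.ofFinite K
    rw [Nat.card_eq_fintype_card]
    exact congrArg Subtype.val (FiniteField.pow_card (⟨x, hx⟩ : K))
  choose a ha using fun i => (Submodule.mem_span_range_iff_exists_fun F).1 (huU i)
  refine eq_zero_of_sum_smul_eq_zero hu ha (congrFun ?_)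
  refine eq_zero_of_sum_mul_primitive_conj_eq_zero (F := F) (s := s) (hm.trans hk) ?_ ?_ hα ?_ ?_
  · refine Nat.le_of_mul_le_mul_left ?_ ht
    rw [← mul_assoc, ← hk, mul_comm]
    exact hms
  · rw [mul_comm, ← hk]
    exact hdm.le
  · intro j
    exact hKpow _ (sum_mem fun i _ => (subfieldSubmodule F K hFK).smul_mem _ (hv i))
  · intro ℓ h1 hs
    rw [← hsum ℓ h1 hs]
    simp_rw [← ha, ← frobeniusAlgEquivOfAlgebraic_pow_apply F ℓ, map_sum, map_smul, map_pow,
      sum_mul, mul_sum, smul_mul_assoc, mul_smul_comm]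
    exact sum_comm
end

section
/- Let s ≥ 1 and let U, V be F_q-linear subspaces of F_{q^m} of dimensions d and r respectively, and suppose the pair (U,V) is good. Then for every b ∈ F_{q^m} there exist a_1,…,a_s ∈ F_{q^m} such that b·u + a_1 u^q + a_2 u^{q^2} + … + a_s u^{q^s} ∈ V for all u ∈ U. -/
open Finset

/-- Let `c` be a matrix over `E` whose columns satisfy no nontrivial relation with coefficients in
the trace-orthogonal of `V`. Then `a ↦ (∑ j, a j * c i j)ᵢ` is surjective modulo `V`. -/
theorem exists_sum_mul_sub_mem_of_trace_orthogonal {F E ι κ : Type*} [Field F] [Field E]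
    [Algebra F E] [FiniteDimensional F E] [Algebra.IsSeparable F E] [Fintype ι] [Fintype κ]
    (V : Submodule F E) (c : ι → κ → E)
    (hc : ∀ w : ι → E, (∀ i, ∀ v ∈ V, Algebra.trace F E (v * w i) = 0) →
      (∀ j, ∑ i, w i * c i j = 0) → ∀ i, w i = 0) (t : ι → E) :
    ∃ a : κ → E, ∀ i, ∑ j, a j * c i j - t i ∈ V := by
  classical
  let Φ : (κ → E) →ₗ[F] (ι → E ⧸ V) := LinearMap.pi fun i =>
    V.mkQ ∘ₗ ∑ j, LinearMap.mulRight F (c i j) ∘ₗ LinearMap.proj j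
  have hΦ : ∀ a i, Φ a i = V.mkQ (∑ j, a j * c i j) := by
    intro a i
    simp [Φ]
  have hsurj : LinearMap.range Φ = ⊤ := by
    by_contra hne
    obtain ⟨f, hf0, hf⟩ := Submodule.exists_le_ker_of_lt_top _ (lt_top_iff_ne_top.mpr hne)
    have hnd := traceForm_nondegenerate F E
    let φ : ι → Module.Dual F E := fun i =>
      f ∘ₗ LinearMap.single F (fun _ => E ⧸ V) i ∘ₗ V.mkQ
    let w : ι → E := fun i => ((Algebra.traceForm F E).toDual hnd).symm (φ i)
    have hw : ∀ i x, Algebra.trace F E (w i * x) = φ i x := by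
      intro i x
      rw [← Algebra.traceForm_apply]
      exact LinearMap.BilinForm.apply_toDual_symm_apply (φ i) x
    have hfφ : ∀ g : ι → E, f (fun i => V.mkQ (g i)) = ∑ i, φ i (g i) := by
      intro g
      conv_lhs => rw [← Finset.univ_sum_single fun i => V.mkQ (g i), map_sum]
      rfl
    have hw0 : ∀ i, w i = 0 := by
      apply hc
      · intro i v hv
        rw [mul_comm, hw]
        have : V.mkQ v = 0 := by simpa using hv
        simp only [φ, LinearMap.comp_apply, this, map_zero]
      · intro j
        refine (hnd.1) _ fun x => ?_
        have h : f (Φ (Pi.single j x)) = 0 := hf ⟨Pi.single j x, rfl⟩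
        rw [funext (hΦ _), hfφ] at h
        rw [Algebra.traceForm_apply, Finset.sum_mul, map_sum, ← h]
        refine Finset.sum_congr rfl fun i _ => ?_
        rw [← hw]
        congr 1
        simp [Pi.single_apply, mul_assoc, mul_comm x]
    apply hf0
    ext i y
    have := hw i y
    simpa [hw0, φ] using this.symm
  obtain ⟨a, ha⟩ := LinearMap.range_eq_top.mp hsurj fun i => V.mkQ (t i)
  refine ⟨a, fun i => ?_⟩
  have := congrFun ha i
  rw [hΦ] at this
  exact (Submodule.Quotient.eq V).mp this

/-- If the pair `(U, V)` (of dimensions `d`, `r`) is good, then for every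
`b ∈ F_{q^m}` there exist `a₁, …, a_s ∈ F_{q^m}` such that
`b·u + a₁ u^q + a₂ u^{q²} + ⋯ + a_s u^{q^s} ∈ V` for all `u ∈ U`. -/
theorem stmt_19 {F E : Type*} [Field F] [Fintype F] [Field E] [Fintype E] [Algebra F E]
    (q m s d r : ℕ) (hq : Fintype.card F = q) (hm : Module.finrank F E = m) (hs1 : 1 ≤ s)
    (U V : Submodule F E) (hU : Module.finrank F U = d) (hV : Module.finrank F V = r)
    (hgood : IsGoodPair q m s hq U V) :
    ∀ b : E, ∃ a : Fin s → E, ∀ u ∈ U,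
      b * u + ∑ ℓ : Fin s, a ℓ * u ^ q ^ ((ℓ : ℕ) + 1) ∈ V := by
  intro b
  subst hq
  let B := Module.finBasis F U
  let u : Fin (Module.finrank F U) → E := fun i => B i
  have hspan : Submodule.span F (Set.range u) = U := by
    have h := congrArg (Submodule.map U.subtype) B.span_eq
    rw [Submodule.map_span, ← Set.range_comp, Submodule.map_top, Submodule.range_subtype] at h
    exact h
  have hli : LinearIndependent F u :=
    B.linearIndependent.map' U.subtype (Submodule.ker_subtype U)
  obtain ⟨a, ha⟩ := exists_sum_mul_sub_mem_of_trace_orthogonal V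
    (fun i (ℓ : Fin s) => u i ^ Fintype.card F ^ ((ℓ : ℕ) + 1))
    (fun w hw hrel => hgood.2 u (fun i => (B i).2) hli hspan w
      (fun i v hv => by
        have h := FiniteField.algebraMap_trace_eq_sum_pow F E (v * w i)
        rw [hw i v hv, map_zero, hm, Nat.card_eq_fintype_card] at h
        exact h.symm)
      (fun ℓ h1 h2 => by
        have h := hrel ⟨ℓ - 1, by omega⟩
        simpa only [Nat.sub_add_cancel h1] using h))
    (fun i => -(b * u i))
  refine ⟨a, fun x hx => ?_⟩
  let L : E →ₗ[F] E := LinearMap.mulLeft F b +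
    ∑ ℓ : Fin s, LinearMap.mulLeft F (a ℓ) ∘ₗ
      (FiniteField.frobeniusAlgHom F E ^ ((ℓ : ℕ) + 1)).toLinearMap
  have hL : ∀ y, L y = b * y + ∑ ℓ : Fin s, a ℓ * y ^ Fintype.card F ^ ((ℓ : ℕ) + 1) := by
    intro y
    simp only [L, LinearMap.add_apply, LinearMap.sum_apply, LinearMap.comp_apply,
      LinearMap.mulLeft_apply, AlgHom.toLinearMap_apply, AlgHom.coe_pow,
      FiniteField.coe_frobeniusAlgHom, pow_iterate]
  have hle : U ≤ V.comap L := by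
    rw [← hspan, Submodule.span_le]
    rintro _ ⟨i, rfl⟩
    rw [SetLike.mem_coe, Submodule.mem_comap, hL]
    simpa [add_comm] using ha i
  rw [← hL]
  exact hle hx
end
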